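/- arXiv:2510.00889 — 4 statements merged into one kernel-verified Lean document; each statement's English description precedes it below -/
import Mathlib

section
/- Let w ∈ F_r have cyclically reduced length ℓ (i.e., the cyclically reduced form of w has length ℓ). Let v_1, v_2, …, v_{ℓ+1} be a sequence of nontrivial primitivity-blocking words in F_r such that there is no cancellation between adjacent terms of the sequence (the concatenation of the reduced words of v_1, …, v_{ℓ+1} is a reduced word), and moreover the last letter of the reduced word of v_{ℓ+1} is not the inverse of the first letter of the reduced word of v_1. Then the product v_1 v_2 ⋯ v_{ℓ+1} is a w-orbit-blocking word. -/
/-- `FG r` is the free group `F_r` of rank `r`, with free generating set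
`x_1, …, x_r` given by `FreeGroup.of 0, …, FreeGroup.of (r-1)`. -/
abbrev FG (r : ℕ) := FreeGroup (Fin r)

/-- `|w|`, the length of the reduced word representing `w`. -/
def wordLength {r : ℕ} (w : FG r) : ℕ := w.toWord.length

/-- `w` is cyclically reduced: its reduced word is empty, or its first letter is not
the inverse of its last letter.  (A letter `(i, b)` has inverse `(i, !b)`.) -/
def CyclicallyReduced {r : ℕ} (w : FG r) : Prop :=
  ∀ a ∈ w.toWord.head?, ∀ b ∈ w.toWord.getLast?, a ≠ (b.1, !b.2)

/-- `p` is a primitive element of `F_r`: the image of `x_1` under some automorphism. -/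
def Primitive {r : ℕ} (hr : 0 < r) (p : FG r) : Prop :=
  ∃ φ : FG r ≃* FG r, φ (FreeGroup.of ⟨0, hr⟩) = p

/-- `v` is primitivity-blocking: the reduced word of `v` is not an infix of the reduced
word of any cyclically reduced primitive element of `F_r`. -/
def PrimitivityBlocking {r : ℕ} (hr : 0 < r) (v : FG r) : Prop :=
  ∀ p : FG r, Primitive hr p → CyclicallyReduced p → ¬ v.toWord <:+: p.toWord

/-- `v` is `w`-orbit-blocking: for every automorphism `φ` with `φ w` cyclically reduced,
the reduced word of `v` is not an infix of the reduced word of `φ w`. -/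
def OrbitBlocking {r : ℕ} (w v : FG r) : Prop :=
  ∀ φ : FG r ≃* FG r, CyclicallyReduced (φ w) → ¬ v.toWord <:+: (φ w).toWord

/-- `u` is positive: every letter of its reduced word is a generator (not an inverse). -/
def Positive {r : ℕ} (u : FG r) : Prop := ∀ l ∈ u.toWord, l.2 = true

/-- The cyclic length `‖u‖`: the minimum of `|g u g⁻¹|` over all `g`. -/
noncomputable def cyclicLength {r : ℕ} (u : FG r) : ℕ :=
  sInf (Set.range fun g : FG r => wordLength (g * u * g⁻¹))

/-- `gen r j` is the generator `x_{j+1}` of `F_r` (0-indexed: the `j`-th generator),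
for `j < r`. -/
def gen (r : ℕ) (j : ℕ) : FG r :=
  if h : j < r then FreeGroup.of ⟨j, h⟩ else 1

/-- `(b_1, …, b_r)` is a basis of `F_r`: some automorphism sends `x_i` to `b_i`. -/
def IsBasis {r : ℕ} (b : Fin r → FG r) : Prop :=
  ∃ φ : FG r ≃* FG r, ∀ i, φ (FreeGroup.of i) = b i

namespace List

variable {α : Type*} {G : List α → Prop}

/-- `l` is a concatenation of `m` lists satisfying `G`. -/
def CoveredBy (G : List α → Prop) : ℕ → List α → Prop
  | 0, l => l = []
  | m + 1, l => ∃ x y, l = x ++ y ∧ G x ∧ CoveredBy G m y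

/-- `l` contains `k` pairwise disjoint infixes violating `G`. -/
def HasDisjointViolations (G : List α → Prop) : ℕ → List α → Prop
  | 0, _ => True
  | k + 1, l => ∃ a v c, l = a ++ v ++ c ∧ ¬ G v ∧ HasDisjointViolations G k c

theorem CoveredBy.of_suffix (hG : ∀ x y, x <:+: y → G y → G x) {m : ℕ} {l s : List α}
    (h : CoveredBy G m l) (hs : s <:+ l) : CoveredBy G m s := by
  induction m generalizing l s with
  | zero =>
    have h' : l = [] := h
    subst h'
    exact suffix_nil.1 hs
  | succ m ih =>
    obtain ⟨x, y, rfl, hx, hy⟩ := h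
    obtain ⟨p, hp⟩ := hs
    rcases append_eq_append_iff.1 hp with ⟨t, rfl, rfl⟩ | ⟨t, rfl, rfl⟩
    · exact ⟨t, y, rfl, hG _ _ (suffix_append p t).isInfix hx, hy⟩
    · exact ⟨[], s, rfl, hG _ _ nil_infix hx, ih hy (suffix_append t s)⟩

theorem HasDisjointViolations.append_left {k : ℕ} {l : List α}
    (h : HasDisjointViolations G k l) (d : List α) : HasDisjointViolations G k (d ++ l) := by
  cases k with
  | zero => trivial
  | succ k =>
    obtain ⟨a, v, c, rfl, hv, hc⟩ := h
    exact ⟨d ++ a, v, c, by simp, hv, hc⟩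

theorem HasDisjointViolations.append {j k : ℕ} {l₁ l₂ : List α}
    (h₁ : HasDisjointViolations G j l₁) (h₂ : HasDisjointViolations G k l₂) :
    HasDisjointViolations G (j + k) (l₁ ++ l₂) := by
  induction j generalizing l₁ with
  | zero => simpa using h₂.append_left l₁
  | succ j ih =>
    obtain ⟨a, v, c, rfl, hv, hc⟩ := h₁
    rw [Nat.succ_add]
    exact ⟨a, v, c ++ l₂, by simp, hv, ih hc⟩

theorem hasDisjointViolations_flatten {L : List (List α)} (h : ∀ v ∈ L, ¬ G v) :
    HasDisjointViolations G L.length L.flatten := by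
  induction L with
  | nil => trivial
  | cons v L ih =>
    exact ⟨[], v, L.flatten, by simp, h v (by simp), ih fun u hu => h u (by simp [hu])⟩

theorem HasDisjointViolations.flatten_replicate {k : ℕ} {l : List α}
    (h : HasDisjointViolations G k l) (n : ℕ) :
    HasDisjointViolations G (n * k) (replicate n l).flatten := by
  induction n with
  | zero => rw [Nat.zero_mul]; trivial
  | succ n ih =>
    rw [replicate_succ, flatten_cons, Nat.succ_mul, Nat.add_comm]
    exact h.append ih

theorem HasDisjointViolations.of_infix {k : ℕ} {s l : List α}
    (h : HasDisjointViolations G k s) (hs : s <:+: l) : HasDisjointViolations G k l := by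
  obtain ⟨a, b, rfl⟩ := hs
  exact (h.append_left a).append (k := 0) trivial

/-- Each of the covering lists meets the start of at most one of the disjoint violations. -/
theorem HasDisjointViolations.le_of_coveredBy (hG : ∀ x y, x <:+: y → G y → G x)
    (hnil : G []) {k m : ℕ} {l : List α}
    (h : HasDisjointViolations G k l) (hl : CoveredBy G m l) : k ≤ m := by
  induction m generalizing k l with
  | zero =>
    cases k with
    | zero => rfl
    | succ k =>
      obtain ⟨a, v, c, h, hv, -⟩ := h
      have h' : l = [] := hl
      simp_all
  | succ m ih =>
    cases k with
    | zero => simp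
    | succ k =>
      obtain ⟨a, v, c, h, hv, hc⟩ := h
      obtain ⟨x, y, rfl, hx, hy⟩ := hl
      rcases append_eq_append_iff.1 h with ⟨d, h₁, rfl⟩ | ⟨d, rfl, h₁⟩
      · exact Nat.succ_le_succ (ih (hc.append_left d) hy)
      · exact absurd (hG _ _ ⟨a, d, by simp⟩ hx) hv

end List

namespace FreeGroup

variable {α : Type*} [DecidableEq α]

theorem exists_toWord_mul_eq_append (x y : FreeGroup α) :
    ∃ a b, (x * y).toWord = a ++ b ∧ a <+: x.toWord ∧ b <:+ y.toWord := by
  suffices H : ∀ l : List (α × Bool), IsReduced l →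
      ∃ a b, reduce (l ++ y.toWord) = a ++ b ∧ a <+: l ∧ b <:+ y.toWord by
    rw [toWord_mul]
    exact H _ isReduced_toWord
  intro l hl
  induction l with
  | nil => exact ⟨[], y.toWord, by simp, List.nil_prefix, List.suffix_rfl⟩
  | cons c l ih =>
    obtain ⟨a, b, h, ha, hb⟩ := ih (hl.infix ⟨[c], [], by simp⟩)
    rw [List.cons_append, reduce.cons, h]
    cases a with
    | cons d a =>
      obtain ⟨t, rfl⟩ := ha
      have hcd : ¬ (c.1 = d.1 ∧ c.2 = !d.2) := by
        rintro ⟨h₁, h₂⟩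
        have := (List.isChain_cons_cons.1 hl).1 h₁
        simp_all
      refine ⟨c :: d :: a, b, by simp [hcd], ⟨t, by simp⟩, hb⟩
    | nil =>
      cases b with
      | nil => exact ⟨[c], [], by simp, ⟨l, rfl⟩, hb⟩
      | cons d b =>
        by_cases hcd : c.1 = d.1 ∧ c.2 = !d.2
        · exact ⟨[], b, by simp [hcd], List.nil_prefix, (List.suffix_cons d b).trans hb⟩
        · exact ⟨[c], d :: b, by simp [hcd], ⟨l, rfl⟩, hb⟩

/-- The automorphism inverting every generator. -/
def invGenerators : FreeGroup α ≃* FreeGroup α :=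
  MonoidHom.toMulEquiv (lift fun i => (of i)⁻¹) (lift fun i => (of i)⁻¹)
    (by ext; simp) (by ext; simp)

/-- The transvection `x_i ↦ x_i x_j`. -/
def transvection {i j : α} (hij : i ≠ j) : FreeGroup α ≃* FreeGroup α :=
  MonoidHom.toMulEquiv (lift fun k => if k = i then of i * of j else of k)
    (lift fun k => if k = i then of i * (of j)⁻¹ else of k)
    (by ext k; by_cases h : k = i <;> simp [h, hij.symm])
    (by ext k; by_cases h : k = i <;> simp [h, hij.symm])

/-- If the images of letters satisfy `G`, then the reduced image of `x` is covered by `x.norm` lists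
satisfying `G`, since cancellation only shortens the pieces. -/
theorem coveredBy_toWord_map {β : Type*} [DecidableEq β] {G : List (β × Bool) → Prop}
    (hG : ∀ x y, x <:+: y → G y → G x) (φ : FreeGroup α →* FreeGroup β)
    (h : ∀ i b, G (φ (mk [(i, b)])).toWord) (x : FreeGroup α) :
    List.CoveredBy G x.norm (φ x).toWord := by
  suffices H : ∀ l : List (α × Bool), List.CoveredBy G l.length (φ (mk l)).toWord by
    simpa [mk_toWord, norm] using H x.toWord
  intro l
  induction l with
  | nil => simp [← one_eq_mk, List.CoveredBy]
  | cons c l ih =>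
    have : φ (mk (c :: l)) = φ (mk [c]) * φ (mk l) := by
      rw [← MonoidHom.map_mul, mul_mk]; rfl
    obtain ⟨a, b, hab, ha, hb⟩ := exists_toWord_mul_eq_append (φ (mk [c])) (φ (mk l))
    rw [this, hab]
    exact ⟨a, b, rfl, hG _ _ ha.isInfix (h c.1 c.2), ih.of_suffix hG hb⟩

/-- Conjugation does not lengthen a word that starts with `e` or ends with its inverse. -/
theorem norm_conj_le {x : FreeGroup α} {e : α × Bool}
    (h : x.toWord.head? = some e ∨ x.toWord.getLast? = some (e.1, !e.2)) :
    ((mk [e])⁻¹ * x * mk [e]).norm ≤ x.norm := by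
  have he : (mk [e]).norm ≤ 1 := norm_mk_le
  have he' : ((mk [e])⁻¹).norm ≤ 1 := by rwa [norm_inv_eq]
  rcases h with h | h
  · obtain ⟨t, ht⟩ := List.head?_eq_some_iff.1 h
    have hx : x = mk [e] * mk t := by rw [mul_mk, ← mk_toWord (x := x), ht]; rfl
    have ht' : (mk t).norm ≤ t.length := norm_mk_le
    have hn : x.norm = t.length + 1 := by simp [norm, ht]
    have : (mk [e])⁻¹ * x * mk [e] = mk t * mk [e] := by rw [hx]; group
    rw [this]
    have := norm_mul_le (mk t) (mk [e])
    omega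
  · obtain ⟨t, ht⟩ := List.getLast?_eq_some_iff.1 h
    have hx : x = mk t * (mk [e])⁻¹ := by
      rw [inv_mk, mul_mk, ← mk_toWord (x := x), ht]; simp [invRev]
    have ht' : (mk t).norm ≤ t.length := norm_mk_le
    have hn : x.norm = t.length + 1 := by simp [norm, ht]
    have : (mk [e])⁻¹ * x * mk [e] = (mk [e])⁻¹ * mk t := by rw [hx]; group
    rw [this]
    have := norm_mul_le (mk [e])⁻¹ (mk t)
    omega

theorem norm_conj_lt {x : FreeGroup α} {e : α × Bool}
    (h₁ : x.toWord.head? = some e) (h₂ : x.toWord.getLast? = some (e.1, !e.2)) :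
    ((mk [e])⁻¹ * x * mk [e]).norm < x.norm := by
  obtain ⟨t, ht⟩ := List.head?_eq_some_iff.1 h₁
  rcases List.eq_nil_or_concat t with rfl | ⟨s, b, rfl⟩
  · simp [ht, Prod.ext_iff] at h₂
  have hb : b = (e.1, !e.2) := by
    rw [ht, List.concat_eq_append, ← List.cons_append, List.getLast?_concat] at h₂
    simpa using h₂
  have hx : x = mk [e] * mk s * (mk [e])⁻¹ := by
    rw [inv_mk, mul_mk, mul_mk, ← mk_toWord (x := x), ht, hb]; simp [invRev]
  have hs : (mk s).norm ≤ s.length := norm_mk_le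
  have hn : x.norm = s.length + 2 := by simp [norm, ht]
  have : (mk [e])⁻¹ * x * mk [e] = mk s := by rw [hx]; group
  rw [this]
  omega

end FreeGroup

theorem cyclicallyReduced_iff {r : ℕ} {w : FG r} :
    CyclicallyReduced w ↔ FreeGroup.IsCyclicallyReduced w.toWord := by
  rw [FreeGroup.isCyclicallyReduced_iff, CyclicallyReduced]
  simp only [FreeGroup.isReduced_toWord, true_and]
  constructor
  · intro h a ha b hb hab
    have := h b hb a ha
    by_contra hne
    exact this (Prod.ext hab.symm (by cases h : a.2 <;> cases h' : b.2 <;> simp_all))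
  · rintro h a ha b hb rfl
    simpa using h b hb _ ha rfl

theorem CyclicallyReduced.inv {r : ℕ} {w : FG r} (h : CyclicallyReduced w) :
    CyclicallyReduced w⁻¹ := by
  intro a ha b hb hab
  simp only [FreeGroup.toWord_inv, FreeGroup.invRev, List.head?_reverse, List.getLast?_reverse,
    List.getLast?_map, List.head?_map, Option.mem_def, Option.map_eq_some_iff] at ha hb
  obtain ⟨a, ha, rfl⟩ := ha
  obtain ⟨b, hb, rfl⟩ := hb
  exact h b hb a ha (by simp_all [Prod.ext_iff])

theorem CyclicallyReduced.toWord_pow {r : ℕ} {w : FG r} (h : CyclicallyReduced w) (n : ℕ) :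
    (w ^ n).toWord = (List.replicate n w.toWord).flatten := by
  rw [FreeGroup.toWord_pow]
  exact ((cyclicallyReduced_iff.1 h).flatten_replicate n).isReduced.reduce_eq

theorem primitive_apply_of {r : ℕ} (hr : 0 < r) (φ : FG r ≃* FG r) (i : Fin r) :
    Primitive hr (φ (FreeGroup.of i)) :=
  ⟨(FreeGroup.freeGroupCongr (Equiv.swap ⟨0, hr⟩ i)).trans φ, by simp⟩

theorem Primitive.inv {r : ℕ} {hr : 0 < r} {p : FG r} (h : Primitive hr p) :
    Primitive hr p⁻¹ := by
  obtain ⟨φ, rfl⟩ := h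
  exact ⟨FreeGroup.invGenerators.trans φ, by simp [FreeGroup.invGenerators]⟩

/-- `l` is an infix of the reduced word of a cyclically reduced primitive element. -/
def IsPrimitiveInfix {r : ℕ} (hr : 0 < r) (l : List (Fin r × Bool)) : Prop :=
  ∃ p : FG r, Primitive hr p ∧ CyclicallyReduced p ∧ l <:+: p.toWord

theorem IsPrimitiveInfix.of_infix {r : ℕ} {hr : 0 < r} (x y : List (Fin r × Bool))
    (h : x <:+: y) : IsPrimitiveInfix hr y → IsPrimitiveInfix hr x := by
  rintro ⟨p, hp, hc, hy⟩
  exact ⟨p, hp, hc, h.trans hy⟩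

theorem isPrimitiveInfix_nil {r : ℕ} (hr : 0 < r) : IsPrimitiveInfix hr [] :=
  ⟨FreeGroup.of ⟨0, hr⟩, ⟨MulEquiv.refl _, rfl⟩, by simp [cyclicallyReduced_iff],
    List.nil_infix⟩

theorem IsPrimitiveInfix.toWord_inv {r : ℕ} {hr : 0 < r} {u : FG r}
    (h : IsPrimitiveInfix hr u.toWord) : IsPrimitiveInfix hr u⁻¹.toWord := by
  obtain ⟨p, hp, hc, a, b, h⟩ := h
  refine ⟨p⁻¹, hp.inv, hc.inv, FreeGroup.invRev b, FreeGroup.invRev a, ?_⟩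
  rw [FreeGroup.toWord_inv, FreeGroup.toWord_inv, ← h]
  simp

/-- If the total length of a basis cannot be decreased by conjugation, then each of its elements
is an infix of a cyclically reduced primitive element. -/
theorem isPrimitiveInfix_of_forall_sum_norm_le {r : ℕ} (hr : 0 < r) (φ : FG r ≃* FG r)
    (hφ : ∀ g : FG r, ∑ i, (φ (FreeGroup.of i)).norm ≤
      ∑ i, (g⁻¹ * φ (FreeGroup.of i) * g).norm) (i : Fin r) :
    IsPrimitiveInfix hr (φ (FreeGroup.of i)).toWord := by
  by_cases hc : CyclicallyReduced (φ (FreeGroup.of i))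
  · exact ⟨_, primitive_apply_of hr φ i, hc, List.infix_rfl⟩
  simp only [CyclicallyReduced, not_forall, not_not, Option.mem_def] at hc
  obtain ⟨e, he, f, hf, hef⟩ := hc
  have hf' : (φ (FreeGroup.of i)).toWord.getLast? = some (e.1, !e.2) := by simp [hf, hef]
  obtain ⟨j, hj₁, hj₂⟩ : ∃ j, (φ (FreeGroup.of j)).toWord.head? ≠ some e ∧
      (φ (FreeGroup.of j)).toWord.getLast? ≠ some (e.1, !e.2) := by
    by_contra! hcon
    refine (hφ (FreeGroup.mk [e])).not_gt
      (Finset.sum_lt_sum (fun j _ => FreeGroup.norm_conj_le ?_)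
        ⟨i, Finset.mem_univ i, FreeGroup.norm_conj_lt he hf'⟩)
    by_cases h : (φ (FreeGroup.of j)).toWord.head? = some e
    · exact Or.inl h
    · exact Or.inr (hcon j h)
  have hij : i ≠ j := fun h => hj₁ (h ▸ he)
  have hred : FreeGroup.IsReduced
      ((φ (FreeGroup.of i)).toWord ++ (φ (FreeGroup.of j)).toWord) := by
    refine List.IsChain.append FreeGroup.isReduced_toWord FreeGroup.isReduced_toWord ?_
    intro a ha b hb hab
    rw [hf', Option.mem_some_iff] at ha
    subst ha
    by_contra hne
    exact hj₁ (hb.trans (congrArg some (Prod.ext hab.symm (by simpa using Ne.symm hne))))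
  have hw : (φ (FreeGroup.of i) * φ (FreeGroup.of j)).toWord =
      (φ (FreeGroup.of i)).toWord ++ (φ (FreeGroup.of j)).toWord := by
    rw [FreeGroup.toWord_mul, hred.reduce_eq]
  have hne : (φ (FreeGroup.of j)).toWord ≠ [] := by simp
  refine ⟨φ (FreeGroup.of i) * φ (FreeGroup.of j), ?_, ?_, hw ▸ List.infix_append [] _ _⟩
  · have := primitive_apply_of hr ((FreeGroup.transvection hij).trans φ) i
    simpa [FreeGroup.transvection] using this
  · rintro a ha b hb rfl
    rw [hw, Option.mem_def, List.head?_append, he] at ha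
    rw [hw, Option.mem_def, List.getLast?_append_of_ne_nil _ hne] at hb
    apply hj₂
    simp at ha
    simp [hb, ha]

theorem exists_conj_isPrimitiveInfix {r : ℕ} (hr : 0 < r) (φ : FG r ≃* FG r) :
    ∃ g : FG r, ∀ i,
      IsPrimitiveInfix hr (φ.trans (MulAut.conj g) (FreeGroup.of i)).toWord := by
  let f : FG r → ℕ := fun g => ∑ i, (φ.trans (MulAut.conj g) (FreeGroup.of i)).norm
  obtain ⟨g, hg⟩ : ∃ g, ∀ h, f g ≤ f h :=
    ⟨Function.argmin f, fun h => Function.argmin_le f h⟩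
  refine ⟨g, isPrimitiveInfix_of_forall_sum_norm_le hr _ fun h => (hg (h⁻¹ * g)).trans_eq ?_⟩
  simp [f, mul_assoc]

theorem exists_norm_conj_eq_cyclicLength {r : ℕ} (w : FG r) :
    ∃ g : FG r, (g * w * g⁻¹).norm = cyclicLength w :=
  Nat.sInf_mem (Set.range_nonempty fun g : FG r => wordLength (g * w * g⁻¹))

theorem toWord_prod_of_reduce_flatten {α : Type*} [DecidableEq α] {L : List (FreeGroup α)}
    (h : FreeGroup.reduce (L.map FreeGroup.toWord).flatten = (L.map FreeGroup.toWord).flatten) :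
    L.prod.toWord = (L.map FreeGroup.toWord).flatten := by
  have : L.prod = FreeGroup.mk (L.map FreeGroup.toWord).flatten := by
    clear h
    induction L with
    | nil => rfl
    | cons a L ih => simp [ih, ← FreeGroup.mul_mk, FreeGroup.mk_toWord]
  rw [this, FreeGroup.toWord_mk, h]

/-- If `w` has cyclically reduced length `ℓ` and `v_1, …, v_{ℓ+1}` are
nontrivial primitivity-blocking words whose reduced words concatenate without cancellation
into a reduced word, and the last letter of `v_{ℓ+1}` is not the inverse of the first
letter of `v_1`, then `v_1 v_2 ⋯ v_{ℓ+1}` is `w`-orbit-blocking. -/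
theorem orbit_blocking_of_product {r : ℕ} (hr : 0 < r) (w : FG r) (ℓ : ℕ)
    (hℓ : cyclicLength w = ℓ)
    (v : Fin (ℓ + 1) → FG r)
    (hnt : ∀ i, v i ≠ 1)
    (hpb : ∀ i, PrimitivityBlocking hr (v i))
    (hred : FreeGroup.reduce (((List.ofFn v).map FreeGroup.toWord).flatten) =
      ((List.ofFn v).map FreeGroup.toWord).flatten)
    (hcyc : ∀ a ∈ (FreeGroup.toWord (v (Fin.last ℓ))).getLast?,
      ∀ b ∈ (FreeGroup.toWord (v 0)).head?, a ≠ (b.1, !b.2)) :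
    OrbitBlocking w (List.ofFn v).prod := by
  intro φ hc hinf
  obtain ⟨g, hg⟩ := exists_conj_isPrimitiveInfix hr φ
  obtain ⟨m, hm⟩ := exists_norm_conj_eq_cyclicLength w
  set ψ := φ.trans (MulAut.conj g)
  obtain ⟨k, hk⟩ : ∃ k, ψ (k * (m * w * m⁻¹) * k⁻¹) = φ w :=
    ⟨φ.symm g⁻¹ * m⁻¹, by simp [ψ, mul_assoc]⟩
  have hletter : ∀ i b, IsPrimitiveInfix hr (ψ (FreeGroup.mk [(i, b)])).toWord := by
    rintro i (_ | _)
    · have : (FreeGroup.mk [(i, false)] : FG r) = (FreeGroup.of i)⁻¹ := rfl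
      rw [this, map_inv]
      exact (hg i).toWord_inv
    · exact hg i
  set n := 2 * k.norm + 1
  have hviol := ((List.hasDisjointViolations_flatten (G := IsPrimitiveInfix hr)
    (L := (List.ofFn v).map FreeGroup.toWord) (by
      simp only [List.mem_map, List.mem_ofFn]
      rintro _ ⟨_, ⟨i, rfl⟩, rfl⟩ ⟨p, hp, hc, h⟩
      exact hpb i p hp hc h)).of_infix (toWord_prod_of_reduce_flatten hred ▸ hinf)
    ).flatten_replicate n
  rw [← hc.toWord_pow, ← hk, ← map_pow, conj_pow] at hviol
  have hle := hviol.le_of_coveredBy IsPrimitiveInfix.of_infix (isPrimitiveInfix_nil hr)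
    (FreeGroup.coveredBy_toWord_map IsPrimitiveInfix.of_infix ψ.toMonoidHom hletter _)
  have hpow : ∀ n : ℕ, ((m * w * m⁻¹) ^ n).norm ≤ n * ℓ := by
    intro n
    induction n with
    | zero => simp
    | succ n ih =>
      rw [pow_succ, Nat.succ_mul]
      exact (FreeGroup.norm_mul_le _ _).trans (by omega)
  have h₁ := FreeGroup.norm_mul_le (k * (m * w * m⁻¹) ^ n) k⁻¹
  have h₂ := FreeGroup.norm_mul_le k ((m * w * m⁻¹) ^ n)
  have h₃ := hpow n
  rw [FreeGroup.norm_inv_eq] at h₁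
  simp only [List.length_map, List.length_ofFn, Nat.mul_succ] at hle
  omega
end

section
/- Let (b_1, …, b_r) be a basis of F_r (i.e., there is an automorphism of F_r sending x_i to b_i for each i) which is CCLR, meaning that for every g ∈ F_r, the sum |g b_1 g⁻¹| + ⋯ + |g b_r g⁻¹| is at least |b_1| + ⋯ + |b_r|. Then for each i, no primitivity-blocking word of F_r occurs as a contiguous subword (infix) of the reduced word of b_i. -/
/-- The basis `b` is CCLR: no simultaneous conjugation decreases the total length. -/
def CCLR {r : ℕ} (b : Fin r → FG r) : Prop :=
  ∀ g : FG r, (∑ i, wordLength (b i)) ≤ ∑ i, wordLength (g * b i * g⁻¹)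

/-- The transvection of a free group sending `x_i` to `x_i x_j` and fixing the other generators. -/
def FreeGroup.transvection_s1 {α : Type*} [DecidableEq α] {i j : α} (h : j ≠ i) :
    FreeGroup α ≃* FreeGroup α :=
  MonoidHom.toMulEquiv
    (FreeGroup.lift fun k => if k = i then FreeGroup.of i * FreeGroup.of j else FreeGroup.of k)
    (FreeGroup.lift fun k => if k = i then FreeGroup.of i * (FreeGroup.of j)⁻¹ else FreeGroup.of k)
    (by ext k; by_cases hk : k = i <;> simp [hk, h])
    (by ext k; by_cases hk : k = i <;> simp [hk, h])

theorem FreeGroup.transvection_of {α : Type*} [DecidableEq α] {i j : α} (h : j ≠ i) :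
    FreeGroup.transvection_s1 h (FreeGroup.of i) = FreeGroup.of i * FreeGroup.of j := by
  simp [FreeGroup.transvection_s1]

theorem IsBasis.primitive {r : ℕ} (hr : 0 < r) {b : Fin r → FG r} (hb : IsBasis b) (i : Fin r) :
    Primitive hr (b i) := by
  obtain ⟨φ, hφ⟩ := hb
  exact hφ i ▸ primitive_apply_of hr φ i

theorem IsBasis.primitive_mul {r : ℕ} (hr : 0 < r) {b : Fin r → FG r} (hb : IsBasis b)
    {i j : Fin r} (h : j ≠ i) : Primitive hr (b i * b j) := by
  obtain ⟨φ, hφ⟩ := hb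
  simpa [FreeGroup.transvection_of, hφ] using
    primitive_apply_of hr ((FreeGroup.transvection_s1 h).trans φ) i

theorem IsBasis.ne_one {r : ℕ} {b : Fin r → FG r} (hb : IsBasis b) (i : Fin r) : b i ≠ 1 := by
  obtain ⟨φ, hφ⟩ := hb
  simp [← hφ]

theorem not_cyclicallyReduced_iff {r : ℕ} {w : FG r} :
    ¬ CyclicallyReduced w ↔
      ∃ (c : Fin r × Bool) (M : List (Fin r × Bool)), w.toWord = c :: M ++ [(c.1, !c.2)] := by
  constructor
  · intro h
    simp only [CyclicallyReduced, not_forall, ne_eq, not_not] at h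
    obtain ⟨c, hc, d, hd, rfl⟩ := h
    rcases List.eq_nil_or_concat w.toWord with hw | ⟨L, e, hw⟩
    · simp [hw] at hc
    · obtain rfl : e = d := by simpa [hw] using hd
      cases L with
      | nil => simp [hw, Prod.ext_iff] at hc
      | cons a M =>
        obtain rfl : a = (e.1, !e.2) := by simpa [hw] using hc
        exact ⟨(e.1, !e.2), M, by simpa using hw⟩
  · rintro ⟨c, M, hw⟩ h
    exact h c (by simp [hw]) (c.1, !c.2) (by simp only [hw, List.getLast?_concat, Option.mem_def])
      (by simp)

theorem FreeGroup.mk_cons_inv_cons {α : Type*} (c : α × Bool) (L : List (α × Bool)) :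
    FreeGroup.mk ((c.1, !c.2) :: c :: L) = FreeGroup.mk L := by
  have h : FreeGroup.Red.Step ((c.1, !c.2) :: c :: L) L := by
    simpa using FreeGroup.Red.Step.not (L₁ := []) (L₂ := L) (x := c.1) (b := !c.2)
  exact Quot.sound h

theorem FreeGroup.mk_append_inv_pair {α : Type*} (c : α × Bool) (L : List (α × Bool)) :
    FreeGroup.mk (L ++ [(c.1, !c.2), c]) = FreeGroup.mk L := by
  have h : FreeGroup.Red.Step (L ++ [(c.1, !c.2), c]) L := by
    simpa using FreeGroup.Red.Step.not (L₁ := L) (L₂ := []) (x := c.1) (b := !c.2)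
  exact Quot.sound h

/-- Conjugation of `w` by the inverse of the letter `c`, on the level of words. -/
theorem FreeGroup.conj_letter_eq_mk {α : Type*} [DecidableEq α] (c : α × Bool) (w : FreeGroup α) :
    FreeGroup.mk [(c.1, !c.2)] * w * (FreeGroup.mk [(c.1, !c.2)])⁻¹ =
      FreeGroup.mk ((c.1, !c.2) :: w.toWord ++ [c]) := by
  conv_lhs => rw [← FreeGroup.mk_toWord (x := w)]
  simp [FreeGroup.inv_mk, FreeGroup.mul_mk, FreeGroup.invRev]

theorem wordLength_conj_letter_le {r : ℕ} {c : Fin r × Bool} {w : FG r}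
    (h : c ∈ w.toWord.head? ∨ (c.1, !c.2) ∈ w.toWord.getLast?) :
    wordLength (FreeGroup.mk [(c.1, !c.2)] * w * (FreeGroup.mk [(c.1, !c.2)])⁻¹) ≤
      wordLength w := by
  rw [FreeGroup.conj_letter_eq_mk]
  rcases h with h | h
  · obtain ⟨T, hT⟩ := List.head?_eq_some_iff.1 h
    rw [hT, List.cons_append, List.cons_append, FreeGroup.mk_cons_inv_cons]
    exact FreeGroup.norm_mk_le.trans (by simp [wordLength, hT])
  · obtain ⟨T, hT⟩ := List.getLast?_eq_some_iff.1 h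
    rw [hT, ← List.cons_append, List.append_assoc, List.singleton_append,
      FreeGroup.mk_append_inv_pair]
    exact FreeGroup.norm_mk_le.trans (by simp [wordLength, hT])

theorem wordLength_conj_letter_lt {r : ℕ} {c : Fin r × Bool} {w : FG r}
    {M : List (Fin r × Bool)} (h : w.toWord = c :: M ++ [(c.1, !c.2)]) :
    wordLength (FreeGroup.mk [(c.1, !c.2)] * w * (FreeGroup.mk [(c.1, !c.2)])⁻¹) <
      wordLength w := by
  rw [FreeGroup.conj_letter_eq_mk, h, List.cons_append, List.cons_append, List.cons_append,
    FreeGroup.mk_cons_inv_cons, List.append_assoc, List.singleton_append,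
    FreeGroup.mk_append_inv_pair]
  exact FreeGroup.norm_mk_le.trans_lt (by simp [wordLength, h])

theorem FreeGroup.toWord_mul_of_not_cancel {α : Type*} [DecidableEq α] {u w : FreeGroup α}
    (h : ∀ a ∈ u.toWord.getLast?, ∀ b ∈ w.toWord.head?, a.1 = b.1 → a.2 = b.2) :
    (u * w).toWord = u.toWord ++ w.toWord := by
  rw [FreeGroup.toWord_mul]
  exact FreeGroup.IsReduced.reduce_eq
    (List.isChain_append.2 ⟨FreeGroup.isReduced_toWord, FreeGroup.isReduced_toWord, h⟩)

/-- In a CCLR basis, if `b_i` begins with `c` and ends with `c⁻¹`, then some `b_j` neither begins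
with `c` nor ends with `c⁻¹`. -/
theorem CCLR.exists_not_head_not_getLast {r : ℕ} {b : Fin r → FG r} (hc : CCLR b) {i : Fin r}
    {c : Fin r × Bool} {M : List (Fin r × Bool)}
    (h : (b i).toWord = c :: M ++ [(c.1, !c.2)]) :
    ∃ j, c ∉ (b j).toWord.head? ∧ (c.1, !c.2) ∉ (b j).toWord.getLast? := by
  by_contra! hcon
  refine (hc (FreeGroup.mk [(c.1, !c.2)])).not_gt (Finset.sum_lt_sum (fun j _ => ?_)
    ⟨i, Finset.mem_univ i, wordLength_conj_letter_lt h⟩)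
  exact wordLength_conj_letter_le (or_iff_not_imp_left.2 (hcon j))

/-- Every element of a CCLR basis is an infix of a cyclically reduced primitive element. -/
theorem CCLR.exists_primitive_infix {r : ℕ} (hr : 0 < r) {b : Fin r → FG r}
    (hb : IsBasis b) (hc : CCLR b) (i : Fin r) :
    ∃ p, Primitive hr p ∧ CyclicallyReduced p ∧ (b i).toWord <:+: p.toWord := by
  by_cases hi : CyclicallyReduced (b i)
  · exact ⟨b i, hb.primitive hr i, hi, List.infix_rfl⟩
  obtain ⟨c, M, hM⟩ := not_cyclicallyReduced_iff.1 hi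
  obtain ⟨j, hj₁, hj₂⟩ := hc.exists_not_head_not_getLast hM
  have hji : j ≠ i := by
    rintro rfl
    simp [hM] at hj₁
  have hmul : (b i * b j).toWord = (b i).toWord ++ (b j).toWord := by
    refine FreeGroup.toWord_mul_of_not_cancel fun x hx y hy hxy => ?_
    obtain rfl : (c.1, !c.2) = x := by
      simpa only [hM, List.getLast?_concat, Option.mem_def, Option.some.injEq] using hx
    by_contra hne
    have hyc : y = c := Prod.ext hxy.symm (by simpa using (Ne.symm hne))
    exact hj₁ (hyc ▸ hy)
  refine ⟨b i * b j, hb.primitive_mul hr hji, ?_, hmul ▸ List.infix_append' [] _ _⟩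
  intro x hx y hy hxy
  have hne : (b j).toWord ≠ [] := by simpa using hb.ne_one j
  obtain rfl : c = x := by simpa [hmul, hM] using hx
  rw [hmul, List.getLast?_append_of_ne_nil _ hne] at hy
  exact hj₂ (by simpa [hxy] using hy)

/-- If `(b_1, …, b_r)` is a CCLR basis of `F_r`, then no
primitivity-blocking word occurs as an infix of the reduced word of any `b_i`. -/
theorem no_pb_infix_of_CCLR_basis {r : ℕ} (hr : 0 < r) (b : Fin r → FG r)
    (hb : IsBasis b) (hc : CCLR b) :
    ∀ i : Fin r, ∀ v : FG r, PrimitivityBlocking hr v →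
      ¬ v.toWord <:+: (b i).toWord := by
  intro i v hv hinf
  obtain ⟨p, hp, hred, hip⟩ := hc.exists_primitive_infix hr hb i
  exact hv p hp hred (hinf.trans hip)
end

section
/- In F_2, the pair (x_1 x_2 x_1⁻¹, x_2 x_1⁻¹) is a basis of F_2 (i.e., there is an automorphism of F_2 sending x_1 to x_1 x_2 x_1⁻¹ and x_2 to x_2 x_1⁻¹), this basis is RCR (there is no letter p such that both basis elements' reduced words begin with p and end with p⁻¹), and yet the element x_1 x_2 x_1⁻¹ is primitivity-blocking in F_2. -/
/-- The basis `b` is RCR: there is no letter `p` such that every `b_i` begins with `p`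
and ends with `p⁻¹`. -/
def RCR {r : ℕ} (b : Fin r → FG r) : Prop :=
  ¬ ∃ p : Fin r × Bool, ∀ i,
    (b i).toWord.head? = some p ∧ (b i).toWord.getLast? = some (p.1, !p.2)

section

open FreeGroup hiding map_mul map_inv

/-! ### Cancellation in free groups -/

section Cancellation

variable {α : Type*} [DecidableEq α]

/-- The length of the longest common prefix of two lists. -/
def lcpLength {β : Type*} [DecidableEq β] : List β → List β → ℕ
  | a :: l, b :: m => if a = b then lcpLength l m + 1 else 0
  | [], _ => 0
  | _ :: _, [] => 0

theorem lcpLength_comm {β : Type*} [DecidableEq β] (l m : List β) :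
    lcpLength l m = lcpLength m l := by
  induction l generalizing m with
  | nil => cases m <;> rfl
  | cons a l ih => cases m <;> grind [lcpLength]

theorem min_lcpLength_le {β : Type*} [DecidableEq β] (l m n : List β) :
    min (lcpLength l m) (lcpLength m n) ≤ lcpLength l n := by
  induction l generalizing m n with
  | nil => simp [lcpLength]
  | cons a l ih => cases m <;> cases n <;> grind [lcpLength]

theorem take_lcpLength {β : Type*} [DecidableEq β] (l m : List β) :
    l.take (lcpLength l m) = m.take (lcpLength l m) := by
  induction l generalizing m with
  | nil => simp [lcpLength]
  | cons a l ih => cases m <;> grind [lcpLength]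

theorem length_reduce_invRev_append {l m : List (α × Bool)} (hl : IsReduced l)
    (hm : IsReduced m) :
    (reduce (invRev l ++ m)).length + 2 * lcpLength l m = l.length + m.length := by
  induction l generalizing m with
  | nil => simp [lcpLength, hm.reduce_eq]
  | cons a l ih =>
    have hl' : reduce (invRev (a :: l)) = invRev (a :: l) := by
      rw [reduce_invRev, hl.reduce_eq]
    cases m with
    | nil => simp [lcpLength, hl']
    | cons b m =>
      by_cases hab : a = b
      · subst hab
        have hred : reduce (invRev (a :: l) ++ a :: m) = reduce (invRev l ++ m) := by
          apply reduce.sound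
          rw [invRev_cons, ← mul_mk, ← mul_mk, ← mul_mk, ← inv_mk,
            show a :: m = [a] ++ m from rfl, ← mul_mk, ← inv_mk]
          group
        have := ih (List.isChain_cons.1 hl).2 (List.isChain_cons.1 hm).2
        rw [hred]
        simp only [lcpLength, if_true, List.length_cons]
        omega
      · have hred : IsReduced (invRev (a :: l) ++ b :: m) := by
          refine List.IsChain.append (IsReduced.of_reduce_eq hl') hm ?_
          intro x hx y hy h
          simp only [invRev, List.map_cons, List.reverse_cons, List.getLast?_append,
            List.getLast?_singleton, Option.some_or, Option.mem_def, Option.some.injEq,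
            List.head?_cons] at hx hy
          subst hx hy
          obtain ⟨i, s⟩ := a
          obtain ⟨j, t⟩ := b
          cases s <;> cases t <;> simp_all
        rw [hred.reduce_eq]
        simp [lcpLength, hab]

/-- The length of the longest common prefix of the reduced words of `x` and `y`. -/
def gromovProduct (x y : FreeGroup α) : ℕ := lcpLength x.toWord y.toWord

theorem gromovProduct_comm (x y : FreeGroup α) : gromovProduct x y = gromovProduct y x :=
  lcpLength_comm _ _

theorem min_gromovProduct_le (x y z : FreeGroup α) :
    min (gromovProduct x y) (gromovProduct y z) ≤ gromovProduct x z :=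
  min_lcpLength_le _ _ _

theorem norm_inv_mul_add (x y : FreeGroup α) :
    norm (x⁻¹ * y) + 2 * gromovProduct x y = norm x + norm y := by
  rw [FreeGroup.norm, toWord_mul, toWord_inv]
  exact length_reduce_invRev_append isReduced_toWord isReduced_toWord

theorem norm_mul_add (x y : FreeGroup α) :
    norm (x * y) + 2 * gromovProduct x⁻¹ y = norm x + norm y := by
  simpa using norm_inv_mul_add x⁻¹ y

theorem norm_lt_norm_mul_self {x : FreeGroup α} (hx : x ≠ 1) : norm x < norm (x * x) := by
  have h1 := reduceCyclically.conj_conjugator_reduceCyclically x.toWord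
  have h2 := reduceCyclically.reduce_flatten_replicate_succ (isReduced_toWord (x := x)) 1
  have hne : reduceCyclically x.toWord ≠ [] := by
    intro h
    rw [h] at h1
    apply hx
    rw [← mk_toWord (x := x), ← h1, ← mul_mk, ← mul_mk, ← inv_mk, ← one_eq_mk]
    group
  have := List.length_pos_iff.2 hne
  have e1 := congrArg List.length h1
  have e2 := congrArg List.length h2
  rw [FreeGroup.norm, FreeGroup.norm, toWord_mul]
  simp only [List.replicate_succ, List.replicate_zero, List.flatten_cons, List.flatten_nil,
    List.append_nil, List.length_append, invRev_length] at e1 e2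
  omega

theorem two_mul_gromovProduct_inv_self_lt {x : FreeGroup α} (hx : x ≠ 1) :
    2 * gromovProduct x⁻¹ x < norm x := by
  have := norm_mul_add x x
  have := norm_lt_norm_mul_self hx
  omega

/-- A reduced product of elements with small cancellation is at least as long as its number of
factors. -/
theorem length_le_norm_prod {β : Type*} (X : β → FreeGroup α) (r : β → β → Prop)
    (hpos : ∀ x, X x ≠ 1)
    (hpair : ∀ x y, r x y → 2 * gromovProduct (X x)⁻¹ (X y) ≤ norm (X x) ∧
      2 * gromovProduct (X x)⁻¹ (X y) ≤ norm (X y))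
    (htriple : ∀ x y z, r x y → r y z →
      gromovProduct (X x)⁻¹ (X y) + gromovProduct (X y)⁻¹ (X z) < norm (X y))
    (l : List β) (hl : l.IsChain r) : l.length ≤ norm (l.map X).prod := by
  have pos : ∀ x, 0 < norm (X x) := fun x =>
    Nat.pos_of_ne_zero fun h => hpos x (norm_eq_zero.1 h)
  have key : ∀ (l : List β) (x : β), (x :: l).IsChain r →
      (∀ y, r y x → gromovProduct (X y)⁻¹ ((x :: l).map X).prod = gromovProduct (X y)⁻¹ (X x)) ∧
      ∃ h, l.length + norm (X x) ≤ norm ((x :: l).map X).prod + h ∧ 2 * h ≤ norm (X x) ∧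
        ∀ y, r y x → gromovProduct (X y)⁻¹ (X x) + h < norm (X x) := by
    intro l
    induction l with
    | nil =>
      intro x _
      refine ⟨by simp, 0, by simp, by simp, fun y hy => ?_⟩
      have := (hpair y x hy).2
      have := pos x
      omega
    | cons z l ih =>
      intro x hx
      rw [List.isChain_cons_cons] at hx
      obtain ⟨hxz, hz⟩ := hx
      obtain ⟨ih1, h, ih2, ih3, ih4⟩ := ih z hz
      have hc := ih1 x hxz
      have hn := norm_mul_add (X x) ((z :: l).map X).prod
      have hp : ((x :: z :: l).map X).prod = X x * ((z :: l).map X).prod := by simp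
      rw [hp]
      set W := ((z :: l).map X).prod
      have h4 := ih4 x hxz
      have hpx := hpair x z hxz
      refine ⟨fun y hy => ?_, gromovProduct (X x)⁻¹ (X z), ?_, hpx.1, fun y hy =>
        htriple y x z hy hxz⟩
      · have ht := htriple y x z hy hxz
        have h5 := norm_inv_mul_add (X x) (X x * W)
        rw [inv_mul_cancel_left] at h5
        have m1 := min_gromovProduct_le (X y)⁻¹ (X x) (X x * W)
        have m2 := min_gromovProduct_le (X y)⁻¹ (X x * W) (X x)
        rw [gromovProduct_comm (X x * W)] at m2
        omega
      · simp only [List.length_cons]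
        omega
  cases l with
  | nil => simp
  | cons x l =>
    obtain ⟨-, h, h1, h2, -⟩ := key l x hl
    have := pos x
    simp only [List.length_cons]
    omega

/-- If `x` and `y` cancel half of `y` on both sides of `y`, then `y` is conjugate to an element
that is not longer, by an element that also shortens `y * x` to the part of `x` that survives. -/
theorem exists_conj_norm_le {x y : FreeGroup α} (h1 : 2 * gromovProduct x⁻¹ y = norm y)
    (h2 : 2 * gromovProduct y⁻¹ x = norm y) (h : norm y ≤ norm x) :
    ∃ p, norm (p⁻¹ * y * p) ≤ norm y ∧ norm (p⁻¹ * (y * x) * p) + norm y ≤ norm x := by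
  obtain ⟨k, hk⟩ : ∃ k, k = gromovProduct x⁻¹ y := ⟨_, rfl⟩
  have hk' : gromovProduct y⁻¹ x = k := by omega
  have e1 := take_lcpLength x⁻¹.toWord y.toWord
  have e2 := take_lcpLength y⁻¹.toWord x.toWord
  change List.take (gromovProduct x⁻¹ y) _ = List.take (gromovProduct x⁻¹ y) _ at e1
  change List.take (gromovProduct y⁻¹ x) _ = List.take (gromovProduct y⁻¹ x) _ at e2
  rw [← hk] at e1 h1
  rw [hk'] at e2
  have f1 := List.take_append_drop k x⁻¹.toWord
  have f2 := List.take_append_drop k y⁻¹.toWord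
  have f3 := List.take_append_drop k x.toWord
  have f4 := List.take_append_drop k y.toWord
  have lx : x.toWord.length = norm x := rfl
  have ly : y.toWord.length = norm y := rfl
  rw [e1] at f1
  rw [e2] at f2
  obtain ⟨P, hP⟩ : ∃ P, P = y.toWord.take k := ⟨_, rfl⟩
  obtain ⟨Q, hQ⟩ : ∃ Q, Q = x.toWord.take k := ⟨_, rfl⟩
  rw [← hP] at f1 f4
  rw [← hQ] at f2 f3
  have lP : P.length = k := by rw [hP, List.length_take]; omega
  have lQ : Q.length = k := by rw [hQ, List.length_take]; omega
  replace f1 := congrArg invRev f1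
  replace f2 := congrArg invRev f2
  rw [toWord_inv, invRev_invRev, invRev_append] at f1 f2
  have hy : y.toWord = P ++ invRev Q := by
    have := f4.trans f2.symm
    rw [← f4, (List.append_inj' this (by simp [lQ, ly]; omega)).2]
  have hx : ∃ M, x.toWord = Q ++ M ++ invRev P := by
    have := f3.trans f1.symm
    rw [List.append_eq_append_iff] at this
    have l1 := congrArg List.length f1
    simp only [List.length_append, invRev_length, lP, lx] at l1
    rcases this with ⟨M, hM1, hM2⟩ | ⟨M, hM1, hM2⟩
    · exact ⟨M, by rw [← f3, hM2, List.append_assoc]⟩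
    · have l2 := congrArg List.length hM1
      simp only [List.length_append, invRev_length, lQ] at l2
      have : M = [] := List.length_eq_zero_iff.1 (by simp at l1 l2; omega)
      subst this
      exact ⟨[], by rw [← f1, hM1]; simp⟩
  obtain ⟨M, hM⟩ := hx
  have gy : y = mk P * (mk Q)⁻¹ := by rw [inv_mk, mul_mk, ← hy, mk_toWord]
  have gx : x = mk Q * mk M * (mk P)⁻¹ := by rw [inv_mk, mul_mk, mul_mk, ← hM, mk_toWord]
  refine ⟨mk P, ?_, ?_⟩
  · have : (mk P)⁻¹ * y * mk P = mk (invRev Q ++ P) := by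
      rw [← mul_mk, ← inv_mk, gy]; group
    rw [this]
    refine norm_mk_le.trans ?_
    simp [lP, lQ]
    omega
  · have : (mk P)⁻¹ * (y * x) * mk P = mk M := by
      rw [gy, gx]; group
    rw [this]
    have l3 := congrArg List.length hM
    simp only [List.length_append, invRev_length, lP, lQ, lx] at l3
    have := norm_mk_le (L₁ := M)
    omega

end Cancellation

/-! ### Elementary automorphisms of the free group of rank two -/

/-- The endomorphism of `F_2` with `x_1 ↦ u` and `x_2 ↦ v`. -/
def endo (u v : FG 2) : FG 2 →* FG 2 := FreeGroup.lift ![u, v]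

@[simp] theorem endo_of_zero (u v : FG 2) : endo u v (of 0) = u := by simp [endo]

@[simp] theorem endo_of_one (u v : FG 2) : endo u v (of 1) = v := by simp [endo]

theorem endo_ext {f g : FG 2 →* FG 2} (h0 : f (of 0) = g (of 0)) (h1 : f (of 1) = g (of 1))
    (w : FG 2) : f w = g w := by
  have : f = g := FreeGroup.ext_hom f g fun i => by fin_cases i <;> assumption
  rw [this]

/-- The positive substitution `x_1 ↦ x_1, x_2 ↦ x_1 x_2`. -/
def substL : FG 2 →* FG 2 := endo (of 0) (of 0 * of 1)

/-- The positive substitution `x_1 ↦ x_1 x_2, x_2 ↦ x_2`. -/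
def substR : FG 2 →* FG 2 := endo (of 0 * of 1) (of 1)

/-- The endomorphism exchanging the generators. -/
def swapGen : FG 2 →* FG 2 := endo (of 1) (of 0)

/-- The endomorphism inverting the second generator. -/
def invSnd : FG 2 →* FG 2 := endo (of 0) (of 1)⁻¹

/-- The endomorphism inverting both generators. -/
def invBoth : FG 2 →* FG 2 := endo (of 0)⁻¹ (of 1)⁻¹

theorem swapGen_swapGen (w : FG 2) : swapGen (swapGen w) = w :=
  endo_ext (f := swapGen.comp swapGen) (g := MonoidHom.id _) (by simp [swapGen])
    (by simp [swapGen]) w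

theorem invSnd_invSnd (w : FG 2) : invSnd (invSnd w) = w :=
  endo_ext (f := invSnd.comp invSnd) (g := MonoidHom.id _) (by simp [invSnd])
    (by simp [invSnd]) w

theorem invSnd_swapGen (w : FG 2) : invSnd (swapGen w) = invBoth (swapGen (invSnd w)) :=
  endo_ext (f := invSnd.comp swapGen) (g := invBoth.comp (swapGen.comp invSnd))
    (by simp [invSnd, swapGen, invBoth]) (by simp [invSnd, swapGen, invBoth]) w

theorem swapGen_substL (w : FG 2) :
    swapGen (substL w) = of 1 * substR (swapGen w) * (of 1)⁻¹ :=
  endo_ext (f := swapGen.comp substL)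
    (g := (MulAut.conj (of 1 : FG 2)).toMonoidHom.comp (substR.comp swapGen))
    (by simp [substL, swapGen, substR]) (by simp [substL, swapGen, substR, mul_assoc]) w

theorem swapGen_substR (w : FG 2) :
    swapGen (substR w) = (of 0)⁻¹ * substL (swapGen w) * (of 0)⁻¹⁻¹ :=
  endo_ext (f := swapGen.comp substR)
    (g := (MulAut.conj (of 0 : FG 2)⁻¹).toMonoidHom.comp (substL.comp swapGen))
    (by simp [substL, swapGen, substR]) (by simp [substL, swapGen, substR]) w

theorem invBoth_substL (w : FG 2) :
    invBoth (substL w) = (of 0)⁻¹ * substL (invBoth w) * (of 0)⁻¹⁻¹ :=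
  endo_ext (f := invBoth.comp substL)
    (g := (MulAut.conj (of 0 : FG 2)⁻¹).toMonoidHom.comp (substL.comp invBoth))
    (by simp [substL, invBoth]) (by simp [substL, invBoth, mul_assoc]) w

theorem invBoth_substR (w : FG 2) :
    invBoth (substR w) = of 1 * substR (invBoth w) * (of 1)⁻¹ :=
  endo_ext (f := invBoth.comp substR)
    (g := (MulAut.conj (of 1 : FG 2)).toMonoidHom.comp (substR.comp invBoth))
    (by simp [substR, invBoth]) (by simp [substR, invBoth]) w

theorem substR_invSnd_substR (w : FG 2) : substR (invSnd (substR w)) = invSnd w :=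
  endo_ext (f := substR.comp (invSnd.comp substR)) (g := invSnd)
    (by simp [substR, invSnd]) (by simp [substR, invSnd]) w

theorem substR_invSnd_substL (w : FG 2) : substR (invSnd (substL w)) = substL (swapGen w) :=
  endo_ext (f := substR.comp (invSnd.comp substL)) (g := substL.comp swapGen)
    (by simp [substR, substL, invSnd, swapGen]) (by simp [substR, substL, invSnd, swapGen]) w

/-! ### Elements generated by positive substitutions -/

/-- The elements obtained from the generators by the positive substitutions, inversion and
conjugation. -/
inductive PosGenerated : FG 2 → Prop
  | of_zero : PosGenerated (of 0)
  | of_one : PosGenerated (of 1)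
  | substL {w : FG 2} : PosGenerated w → PosGenerated (substL w)
  | substR {w : FG 2} : PosGenerated w → PosGenerated (substR w)
  | inv {w : FG 2} : PosGenerated w → PosGenerated w⁻¹
  | conj (g : FG 2) {w : FG 2} : PosGenerated w → PosGenerated (g * w * g⁻¹)

namespace PosGenerated

theorem swapGen {w : FG 2} (h : PosGenerated w) : PosGenerated (swapGen w) := by
  induction h with
  | of_zero => simpa [_root_.swapGen] using of_one
  | of_one => simpa [_root_.swapGen] using of_zero
  | substL _ ih => rw [swapGen_substL]; exact ih.substR.conj _
  | substR _ ih => rw [swapGen_substR]; exact ih.substL.conj _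
  | inv _ ih => rw [map_inv]; exact ih.inv
  | conj g _ ih => rw [map_mul, map_mul, map_inv]; exact ih.conj _

theorem invBoth {w : FG 2} (h : PosGenerated w) : PosGenerated (invBoth w) := by
  induction h with
  | of_zero => simpa [_root_.invBoth] using of_zero.inv
  | of_one => simpa [_root_.invBoth] using of_one.inv
  | substL _ ih => rw [invBoth_substL]; exact ih.substL.conj _
  | substR _ ih => rw [invBoth_substR]; exact ih.substR.conj _
  | inv _ ih => rw [map_inv]; exact ih.inv
  | conj g _ ih => rw [map_mul, map_mul, map_inv]; exact ih.conj _

theorem exists_conj_mem {w : FG 2} (h : PosGenerated w) :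
    ∃ g, g * w * g⁻¹ ∈ Submonoid.closure {of 0, of 1} ∨
      (g * w * g⁻¹)⁻¹ ∈ Submonoid.closure {of 0, of 1} := by
  have h0 : (of 0 : FG 2) ∈ Submonoid.closure {of 0, of 1} := Submonoid.subset_closure (by simp)
  have h1 : (of 1 : FG 2) ∈ Submonoid.closure {of 0, of 1} := Submonoid.subset_closure (by simp)
  have map_mem : ∀ (f : FG 2 →* FG 2) (w : FG 2), f (of 0) ∈ Submonoid.closure {of 0, of 1} →
      f (of 1) ∈ Submonoid.closure {of 0, of 1} →
      (∃ g, g * w * g⁻¹ ∈ Submonoid.closure {of 0, of 1} ∨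
        (g * w * g⁻¹)⁻¹ ∈ Submonoid.closure {of 0, of 1}) →
      ∃ g, g * f w * g⁻¹ ∈ Submonoid.closure {of 0, of 1} ∨
        (g * f w * g⁻¹)⁻¹ ∈ Submonoid.closure {of 0, of 1} := by
    rintro f w hf0 hf1 ⟨g, hg⟩
    have hle : Submonoid.closure {of 0, of 1} ≤ (Submonoid.closure {of 0, of 1}).comap f := by
      rw [Submonoid.closure_le]
      rintro _ (rfl | rfl)
      exacts [hf0, hf1]
    refine ⟨f g, ?_⟩
    rw [← map_inv, ← map_mul, ← map_mul, ← map_inv]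
    exact hg.imp (@hle _) (@hle _)
  induction h with
  | of_zero => exact ⟨1, .inl (by simpa using h0)⟩
  | of_one => exact ⟨1, .inl (by simpa using h1)⟩
  | @substL w _ ih =>
    exact map_mem _ w (by simpa [_root_.substL] using h0)
      (by simpa [_root_.substL] using mul_mem h0 h1) ih
  | @substR w _ ih =>
    exact map_mem _ w (by simpa [_root_.substR] using mul_mem h0 h1)
      (by simpa [_root_.substR] using h1) ih
  | inv _ ih =>
    obtain ⟨g, hg⟩ := ih
    exact ⟨g, by simpa [mul_assoc, or_comm] using hg⟩
  | conj k _ ih =>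
    obtain ⟨g, hg⟩ := ih
    exact ⟨g * k⁻¹, by simpa [mul_assoc] using hg⟩

end PosGenerated

/-- The elements that lie in the positively generated class up to inverting `x_2`. -/
def SignedGenerated (w : FG 2) : Prop := PosGenerated w ∨ PosGenerated (invSnd w)

namespace SignedGenerated

theorem inv {w : FG 2} (h : SignedGenerated w) : SignedGenerated w⁻¹ := by
  rw [SignedGenerated, map_inv]
  exact h.imp .inv .inv

theorem conj (g : FG 2) {w : FG 2} (h : SignedGenerated w) :
    SignedGenerated (g * w * g⁻¹) := by
  rw [SignedGenerated, map_mul, map_mul, map_inv]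
  exact h.imp (.conj _) (.conj _)

theorem invSnd {w : FG 2} (h : SignedGenerated w) : SignedGenerated (invSnd w) := by
  rw [SignedGenerated, invSnd_invSnd]
  exact h.symm

theorem swapGen {w : FG 2} (h : SignedGenerated w) : SignedGenerated (swapGen w) := by
  rcases h with h | h
  · exact .inl h.swapGen
  · refine .inr ?_
    rw [invSnd_swapGen]
    exact h.swapGen.invBoth

theorem substR {w : FG 2} (h : SignedGenerated w) : SignedGenerated (substR w) := by
  have key : ∀ q, PosGenerated q → SignedGenerated (_root_.substR (_root_.invSnd q)) := by
    intro q hq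
    induction hq with
    | of_zero => exact .inl (by simpa [_root_.invSnd] using PosGenerated.of_zero.substR)
    | of_one =>
      exact .inl (by simpa [_root_.invSnd, _root_.substR] using PosGenerated.of_one.inv)
    | @substL q hq _ => rw [substR_invSnd_substL]; exact .inl hq.swapGen.substL
    | @substR q hq _ =>
      rw [substR_invSnd_substR]; exact .inr (by rwa [invSnd_invSnd])
    | inv _ ih => rw [map_inv, map_inv]; exact ih.inv
    | conj g _ ih => simp only [map_mul, map_inv]; exact ih.conj _
  rcases h with h | h
  · exact .inl h.substR
  · simpa only [invSnd_invSnd] using key _ h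

end SignedGenerated

/-- The automorphisms of `F_2` under which the class `SignedGenerated` is stable. -/
def signedStabilizer : Subgroup (MulAut (FG 2)) where
  carrier := {φ | ∀ w, SignedGenerated (φ w) ↔ SignedGenerated w}
  mul_mem' hφ hψ w := (hφ _).trans (hψ w)
  one_mem' _ := Iff.rfl
  inv_mem' {φ} hφ w := by simpa using (hφ (φ⁻¹ w)).symm

theorem conj_mem_signedStabilizer (g : FG 2) : MulAut.conj g ∈ signedStabilizer := by
  intro w
  refine ⟨fun h => ?_, fun h => h.conj g⟩
  have := h.conj g⁻¹
  rw [MulAut.conj_apply] at this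
  convert this using 1
  group

/-- The automorphism exchanging the generators. -/
def swapAut : MulAut (FG 2) := swapGen.toMulEquiv swapGen (MonoidHom.ext swapGen_swapGen)
  (MonoidHom.ext swapGen_swapGen)

/-- The automorphism inverting the second generator. -/
def invSndAut : MulAut (FG 2) := invSnd.toMulEquiv invSnd (MonoidHom.ext invSnd_invSnd)
  (MonoidHom.ext invSnd_invSnd)

/-- The automorphism `x_1 ↦ x_1 x_2, x_2 ↦ x_2`. -/
def substRAut : MulAut (FG 2) := substR.toMulEquiv (invSnd.comp (substR.comp invSnd))
  (MonoidHom.ext fun w => by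
    simp [substR_invSnd_substR, invSnd_invSnd])
  (MonoidHom.ext fun w => by
    simp [substR_invSnd_substR, invSnd_invSnd])

theorem swapAut_mem : swapAut ∈ signedStabilizer := fun w =>
  ⟨fun h => swapGen_swapGen w ▸ h.swapGen, fun h => h.swapGen⟩

theorem invSndAut_mem : invSndAut ∈ signedStabilizer := fun w =>
  ⟨fun h => invSnd_invSnd w ▸ h.invSnd, fun h => h.invSnd⟩

theorem substRAut_mem : substRAut ∈ signedStabilizer := fun w =>
  ⟨fun h => substRAut.symm_apply_apply w ▸ h.invSnd.substR.invSnd, fun h => h.substR⟩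

theorem mulAut_ext {φ ψ : MulAut (FG 2)} (h0 : φ (of 0) = ψ (of 0)) (h1 : φ (of 1) = ψ (of 1)) :
    φ = ψ :=
  MulEquiv.ext (endo_ext (f := φ.toMonoidHom) (g := ψ.toMonoidHom) h0 h1)

theorem exists_mem_signedStabilizer_letters (x y : Fin 2 × Bool) (hxy : x.1 ≠ y.1) :
    ∃ π ∈ signedStabilizer, π (of 0) = mk [x] ∧ π (of 1) = mk [y] := by
  have s0 : swapAut (of 0) = of 1 := (endo_of_zero _ _ : swapGen (of 0) = _)
  have s1 : swapAut (of 1) = of 0 := (endo_of_one _ _ : swapGen (of 1) = _)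
  have t0 : invSndAut (of 0) = of 0 := (endo_of_zero _ _ : invSnd (of 0) = _)
  have t1 : invSndAut (of 1) = (of 1)⁻¹ := (endo_of_one _ _ : invSnd (of 1) = _)
  have hs := swapAut_mem
  have ht := invSndAut_mem
  have hm := fun {a b : MulAut (FG 2)} => signedStabilizer.mul_mem (x := a) (y := b)
  have hu := hm hs (hm ht hs)
  obtain ⟨i, s⟩ := x
  obtain ⟨j, t⟩ := y
  have inv_of : ∀ i : Fin 2, (of i)⁻¹ = mk [(i, false)] := fun i => rfl
  have of_def : ∀ i : Fin 2, of i = mk [(i, true)] := fun i => rfl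
  fin_cases i <;> fin_cases j <;> simp at hxy <;> cases s <;> cases t <;>
    simp only [Fin.zero_eta, Fin.mk_one, ← inv_of, ← of_def]
  · exact ⟨_, hm hu ht, by simp [s0, s1, t0, t1]⟩
  · exact ⟨_, hu, by simp [s0, s1, t0, t1]⟩
  · exact ⟨_, ht, by simp [t0, t1]⟩
  · exact ⟨1, signedStabilizer.one_mem, by simp⟩
  · exact ⟨_, hm (hm hu ht) hs, by simp [s0, s1, t0, t1]⟩
  · exact ⟨_, hm ht hs, by simp [s0, s1, t0, t1]⟩
  · exact ⟨_, hm hs ht, by simp [s0, s1, t0, t1]⟩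
  · exact ⟨_, hs, by simp [s0, s1]⟩

/-! ### Nielsen reduction -/

/-- The total length of the basis `(φ x_1, φ x_2)`. -/
def basisLength (φ : MulAut (FG 2)) : ℕ := FreeGroup.norm (φ (of 0)) + FreeGroup.norm (φ (of 1))

/-- `φ` has minimal total length in its left coset of `signedStabilizer`. -/
def IsNielsenMinimal (φ : MulAut (FG 2)) : Prop :=
  ∀ ν ∈ signedStabilizer, basisLength φ ≤ basisLength (φ * ν)

theorem mk_singleton_not (x : Fin 2 × Bool) : (mk [(x.1, !x.2)] : FG 2) = (mk [x])⁻¹ := by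
  simp [inv_mk, invRev]

theorem norm_apply_mk_singleton (φ : MulAut (FG 2)) (x : Fin 2 × Bool) :
    FreeGroup.norm (φ (mk [x])) = FreeGroup.norm (φ (of x.1)) := by
  obtain ⟨i, _ | _⟩ := x
  · rw [show (mk [(i, false)] : FG 2) = (of i)⁻¹ from rfl, map_inv, norm_inv_eq]
  · rfl

theorem apply_mk_singleton_ne_one (φ : MulAut (FG 2)) (x : Fin 2 × Bool) : φ (mk [x]) ≠ 1 := by
  rw [map_ne_one_iff φ φ.injective]
  obtain ⟨i, _ | _⟩ := x
  · exact inv_ne_one.2 (of_ne_one i)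
  · exact of_ne_one i

namespace IsNielsenMinimal

variable {φ : MulAut (FG 2)}

theorem norm_le_norm_mul (h : IsNielsenMinimal φ) :
    FreeGroup.norm (φ (of 0)) ≤ FreeGroup.norm (φ (of 0) * φ (of 1)) := by
  have := h _ substRAut_mem
  have e0 : substRAut (of 0) = of 0 * of 1 := (endo_of_zero _ _ : substR (of 0) = _)
  have e1 : substRAut (of 1) = of 1 := (endo_of_one _ _ : substR (of 1) = _)
  simp only [basisLength, MulAut.mul_apply, e0, e1, map_mul] at this
  omega

theorem not_half_cancel (h : IsNielsenMinimal φ)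
    (h1 : 2 * gromovProduct (φ (of 0))⁻¹ (φ (of 1)) = FreeGroup.norm (φ (of 1)))
    (h2 : 2 * gromovProduct (φ (of 1))⁻¹ (φ (of 0)) = FreeGroup.norm (φ (of 1)))
    (hle : FreeGroup.norm (φ (of 1)) ≤ FreeGroup.norm (φ (of 0))) : False := by
  have hpos : FreeGroup.norm (φ (of 1)) ≠ 0 := by simp [FreeGroup.norm_eq_zero]
  obtain ⟨p, hp1, hp2⟩ := exists_conj_norm_le h1 h2 hle
  have hmem := mul_mem (conj_mem_signedStabilizer (φ⁻¹ p⁻¹ * of 1)) substRAut_mem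
  have := h _ hmem
  have e0 : substRAut (of 0) = of 0 * of 1 := (endo_of_zero _ _ : substR (of 0) = _)
  have e1 : substRAut (of 1) = of 1 := (endo_of_one _ _ : substR (of 1) = _)
  have c0 : φ (φ⁻¹ p⁻¹ * of 1 * (of 0 * of 1) * (φ⁻¹ p⁻¹ * of 1)⁻¹) =
      p⁻¹ * (φ (of 1) * φ (of 0)) * p := by
    simp [mul_assoc]
  have c1 : φ (φ⁻¹ p⁻¹ * of 1 * of 1 * (φ⁻¹ p⁻¹ * of 1)⁻¹) = p⁻¹ * φ (of 1) * p := by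
    simp [mul_assoc]
  simp only [basisLength, MulAut.mul_apply, e0, e1, MulAut.conj_apply, c0, c1] at this
  omega

theorem mul_of_letters (h : IsNielsenMinimal φ) {π : MulAut (FG 2)} (hπ : π ∈ signedStabilizer)
    {x y : Fin 2 × Bool} (hxy : x.1 ≠ y.1) (hx : π (of 0) = mk [x]) (hy : π (of 1) = mk [y]) :
    IsNielsenMinimal (φ * π) := by
  intro ν hν
  have := h _ (mul_mem hπ hν)
  rw [← mul_assoc] at this
  refine le_trans (le_of_eq ?_) this
  simp only [basisLength, MulAut.mul_apply, hx, hy, norm_apply_mk_singleton]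
  obtain ⟨i, s⟩ := x
  obtain ⟨j, t⟩ := y
  fin_cases i <;> fin_cases j <;> simp at hxy ⊢
  exact add_comm _ _

theorem norm_le_norm_mul_letters (h : IsNielsenMinimal φ) {x y : Fin 2 × Bool}
    (hxy : x.1 ≠ y.1) :
    FreeGroup.norm (φ (mk [x])) ≤ FreeGroup.norm (φ (mk [x]) * φ (mk [y])) := by
  obtain ⟨π, hπ, hx, hy⟩ := exists_mem_signedStabilizer_letters x y hxy
  simpa [hx, hy] using (h.mul_of_letters hπ hxy hx hy).norm_le_norm_mul

theorem two_mul_gromovProduct_le_right (h : IsNielsenMinimal φ) {x y : Fin 2 × Bool}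
    (hxy : x.1 ≠ y.1) :
    2 * gromovProduct (φ (mk [x]))⁻¹ (φ (mk [y])) ≤ FreeGroup.norm (φ (mk [y])) := by
  have := h.norm_le_norm_mul_letters hxy
  have := norm_mul_add (φ (mk [x])) (φ (mk [y]))
  omega

theorem two_mul_gromovProduct_le (h : IsNielsenMinimal φ) {x y : Fin 2 × Bool}
    (hxy : x.1 = y.1 → x.2 = y.2) :
    2 * gromovProduct (φ (mk [x]))⁻¹ (φ (mk [y])) ≤ FreeGroup.norm (φ (mk [x])) ∧
      2 * gromovProduct (φ (mk [x]))⁻¹ (φ (mk [y])) ≤ FreeGroup.norm (φ (mk [y])) := by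
  by_cases hne : x.1 = y.1
  · obtain rfl : x = y := Prod.ext hne (hxy hne)
    have := two_mul_gromovProduct_inv_self_lt (apply_mk_singleton_ne_one φ x)
    omega
  · refine ⟨?_, h.two_mul_gromovProduct_le_right hne⟩
    have := h.two_mul_gromovProduct_le_right (x := (y.1, !y.2)) (y := (x.1, !x.2))
      (Ne.symm hne)
    rwa [mk_singleton_not, mk_singleton_not, map_inv, map_inv, inv_inv, norm_inv_eq,
      gromovProduct_comm] at this

theorem gromovProduct_add_lt (h : IsNielsenMinimal φ) {x y z : Fin 2 × Bool}
    (hxy : x.1 = y.1 → x.2 = y.2) (hyz : y.1 = z.1 → y.2 = z.2) :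
    gromovProduct (φ (mk [x]))⁻¹ (φ (mk [y])) + gromovProduct (φ (mk [y]))⁻¹ (φ (mk [z])) <
      FreeGroup.norm (φ (mk [y])) := by
  have h1 := h.two_mul_gromovProduct_le hxy
  have h2 := (h.two_mul_gromovProduct_le hyz).1
  have h3 := two_mul_gromovProduct_inv_self_lt (apply_mk_singleton_ne_one φ y)
  by_contra hcon
  by_cases hxy' : x.1 = y.1
  · obtain rfl : x = y := Prod.ext hxy' (hxy hxy')
    omega
  by_cases hyz' : y.1 = z.1
  · obtain rfl : y = z := Prod.ext hyz' (hyz hyz')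
    omega
  have hxz : x.1 = z.1 := by omega
  by_cases hs : x.2 = z.2
  · obtain rfl : x = z := Prod.ext hxz hs
    obtain ⟨π, hπ, ex, ey⟩ := exists_mem_signedStabilizer_letters x y hxy'
    refine (h.mul_of_letters hπ hxy' ex ey).not_half_cancel ?_ ?_ ?_ <;>
      simp only [MulAut.mul_apply, ex, ey] <;> omega
  · obtain rfl : z = (x.1, !x.2) := Prod.ext hxz.symm (by cases h : x.2 <;> simp_all)
    rw [mk_singleton_not, map_inv] at h2 hcon
    have := min_gromovProduct_le (φ (mk [y]))⁻¹ (φ (mk [x]))⁻¹ (φ (mk [y]))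
    omega

theorem exists_letter_of_norm_le_one (h : IsNielsenMinimal φ) {w : FG 2} (hw : w ≠ 1)
    (hle : FreeGroup.norm (φ w) ≤ 1) : ∃ x, w = mk [x] := by
  have hlen := length_le_norm_prod (fun x => φ (mk [x])) (fun x y => x.1 = y.1 → x.2 = y.2)
    (apply_mk_singleton_ne_one φ)
    (fun x y => h.two_mul_gromovProduct_le) (fun x y z => h.gromovProduct_add_lt)
    w.toWord isReduced_toWord
  have hprod : ∀ l : List (Fin 2 × Bool), (l.map fun x => φ (mk [x])).prod = φ (mk l) := by
    intro l
    induction l with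
    | nil => simp [← one_eq_mk]
    | cons x l ih =>
      rw [List.map_cons, List.prod_cons, ih, ← map_mul, mul_mk]
      rfl
  rw [hprod, mk_toWord] at hlen
  have : w.toWord.length ≠ 0 := fun h0 => hw (norm_eq_zero.1 h0)
  obtain ⟨x, hx⟩ := List.length_eq_one_iff.1 (by omega : w.toWord.length = 1)
  exact ⟨x, by rw [← hx, mk_toWord]⟩

theorem mem_signedStabilizer (h : IsNielsenMinimal φ) : φ ∈ signedStabilizer := by
  obtain ⟨x, hx⟩ := h.exists_letter_of_norm_le_one (w := φ⁻¹ (of 0)) (by simp) (by simp)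
  obtain ⟨y, hy⟩ := h.exists_letter_of_norm_le_one (w := φ⁻¹ (of 1)) (by simp) (by simp)
  have hxy : x.1 ≠ y.1 := by
    intro hxy
    have hne : x ≠ y := by
      rintro rfl
      have := φ⁻¹.injective (hx.trans hy.symm)
      exact absurd (of_injective this) (by decide)
    have : y = (x.1, !x.2) := Prod.ext hxy.symm (by
      have : x.2 ≠ y.2 := fun h => hne (Prod.ext hxy h)
      cases h : x.2 <;> simp_all)
    rw [this, mk_singleton_not, ← hx, ← map_inv] at hy
    have := φ⁻¹.injective hy
    revert this
    decide
  obtain ⟨π, hπ, ex, ey⟩ := exists_mem_signedStabilizer_letters x y hxy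
  have : φ⁻¹ = π := mulAut_ext (hx.trans ex.symm) (hy.trans ey.symm)
  rw [← inv_mem_iff, this]
  exact hπ

end IsNielsenMinimal

theorem signedStabilizer_eq_top : signedStabilizer = ⊤ := by
  rw [eq_top_iff]
  intro φ _
  obtain ⟨ν, hν, hmin⟩ : ∃ ν ∈ signedStabilizer, ∀ ν' ∈ signedStabilizer,
      basisLength (φ * ν) ≤ basisLength (φ * ν') := by
    have hwf := (measure fun ν => basisLength (φ * ν)).wf.has_min
      (signedStabilizer : Set (MulAut (FG 2))) ⟨1, one_mem _⟩
    obtain ⟨ν, hν, hmin⟩ := hwf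
    exact ⟨ν, hν, fun ν' hν' => not_lt.1 (hmin ν' hν')⟩
  have h : IsNielsenMinimal (φ * ν) := fun ν' hν' => by
    rw [mul_assoc]
    exact hmin _ (mul_mem hν hν')
  exact (mul_mem_cancel_right hν).1 h.mem_signedStabilizer

theorem Primitive.signedGenerated {hr : 0 < 2} {p : FG 2} (hp : Primitive hr p) :
    SignedGenerated p := by
  obtain ⟨φ, rfl⟩ := hp
  have : φ ∈ signedStabilizer := signedStabilizer_eq_top ▸ Subgroup.mem_top _
  exact (this _).2 (.inl .of_zero)

/-! ### Cyclically reduced words and signs of letters -/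

section Count

variable {α : Type*} [DecidableEq α]

theorem count_toWord_mul_le (l : α × Bool) (x y : FreeGroup α) :
    (x * y).toWord.count l ≤ x.toWord.count l + y.toWord.count l := by
  rw [← List.count_append]
  exact (toWord_mul_sublist x y).count_le l

/-- The elements whose reduced word avoids the letter `l`. -/
def avoiding (l : α × Bool) : Submonoid (FreeGroup α) where
  carrier := {x | x.toWord.count l = 0}
  one_mem' := by simp
  mul_mem' {x y} hx hy := by
    have := count_toWord_mul_le l x y
    simp only [Set.mem_ofPred_eq] at *
    omega

theorem mem_avoiding {l : α × Bool} {x : FreeGroup α} :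
    x ∈ avoiding l ↔ x.toWord.count l = 0 := Iff.rfl

theorem count_eq_zero_of_conj_mem_avoiding {l : α × Bool} {p g : FreeGroup α}
    (hp : IsCyclicallyReduced p.toWord) (hg : g * p * g⁻¹ ∈ avoiding l) :
    p.toWord.count l = 0 := by
  have hpow : ∀ n, (p ^ n).toWord.count l = n * p.toWord.count l := by
    intro n
    rw [toWord_pow, (hp.flatten_replicate n).isReduced.reduce_eq, List.count_flatten]
    simp
  have hz := fun n => pow_mem hg n
  obtain ⟨n, hn⟩ : ∃ n, n = g⁻¹.toWord.count l + g.toWord.count l + 1 := ⟨_, rfl⟩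
  have h0 : ((g * p * g⁻¹) ^ n).toWord.count l = 0 := hz n
  have e : p ^ n = g⁻¹ * (g * p * g⁻¹) ^ n * g := by rw [conj_pow]; group
  have h1 := count_toWord_mul_le l (g⁻¹ * (g * p * g⁻¹) ^ n) g
  have h2 := count_toWord_mul_le l g⁻¹ ((g * p * g⁻¹) ^ n)
  rw [← e, hpow] at h1
  by_contra hne
  have := Nat.le_mul_of_pos_right n (Nat.pos_of_ne_zero hne)
  omega

end Count

theorem CyclicallyReduced.isCyclicallyReduced {r : ℕ} {w : FG r} (h : CyclicallyReduced w) :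
    IsCyclicallyReduced w.toWord := by
  refine ⟨isReduced_toWord, fun a ha b hb hab => ?_⟩
  have := h b hb a ha
  obtain ⟨i, s⟩ := a
  obtain ⟨j, t⟩ := b
  cases s <;> cases t <;> simp_all

theorem SignedGenerated.exists_conj_mem_avoiding {w : FG 2} (h : SignedGenerated w) :
    ∃ g s, g * w * g⁻¹ ∈ avoiding (0, s) := by
  have hinv : ∀ {x : FG 2}, x⁻¹ ∈ avoiding (0, false) → x ∈ avoiding (0, true) := by
    intro x hx
    simpa [mem_avoiding, List.count_eq_zero, invRev] using hx
  rcases h with h | h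
  · obtain ⟨g, hg⟩ := h.exists_conj_mem
    have hle : Submonoid.closure {of 0, of 1} ≤ avoiding ((0, false) : Fin 2 × Bool) := by
      rw [Submonoid.closure_le]
      rintro _ (rfl | rfl) <;> simp [mem_avoiding]
    rcases hg with hg | hg
    · exact ⟨g, false, hle hg⟩
    · exact ⟨g, true, hinv (hle hg)⟩
  · obtain ⟨g, hg⟩ := h.exists_conj_mem
    have hle : Submonoid.closure {of 0, of 1} ≤
        (avoiding ((0, false) : Fin 2 × Bool)).comap _root_.invSnd := by
      rw [Submonoid.closure_le]
      rintro _ (rfl | rfl) <;> simp [mem_avoiding, _root_.invSnd, invRev]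
    refine ⟨_root_.invSnd g, ?_⟩
    have e : _root_.invSnd (g * _root_.invSnd w * g⁻¹) =
        _root_.invSnd g * w * (_root_.invSnd g)⁻¹ := by
      simp [invSnd_invSnd]
    rw [← e]
    rcases hg with hg | hg
    · exact ⟨false, hle hg⟩
    · refine ⟨true, hinv ?_⟩
      rw [← map_inv]
      exact hle hg

end

/-- In `F_2`, `(x_1 x_2 x_1⁻¹, x_2 x_1⁻¹)` is an RCR basis, yet
`x_1 x_2 x_1⁻¹` is primitivity-blocking. -/
theorem RCR_basis_with_pb_element_in_F2 :
    IsBasis (![FreeGroup.of 0 * FreeGroup.of 1 * (FreeGroup.of 0)⁻¹,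
               FreeGroup.of 1 * (FreeGroup.of 0)⁻¹] : Fin 2 → FG 2) ∧
    RCR (![FreeGroup.of 0 * FreeGroup.of 1 * (FreeGroup.of 0)⁻¹,
           FreeGroup.of 1 * (FreeGroup.of 0)⁻¹] : Fin 2 → FG 2) ∧
    PrimitivityBlocking (by norm_num)
      (FreeGroup.of 0 * FreeGroup.of 1 * (FreeGroup.of 0)⁻¹ : FG 2) := by
  refine ⟨?_, ?_, ?_⟩
  · let f : FG 2 →* FG 2 := endo (FreeGroup.of 0 * FreeGroup.of 1 * (FreeGroup.of 0)⁻¹)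
      (FreeGroup.of 1 * (FreeGroup.of 0)⁻¹)
    let g : FG 2 →* FG 2 := endo (FreeGroup.of 0 * (FreeGroup.of 1)⁻¹)
      (FreeGroup.of 1 * FreeGroup.of 0 * (FreeGroup.of 1)⁻¹)
    refine ⟨f.toMulEquiv g (MonoidHom.ext (endo_ext ?_ ?_)) (MonoidHom.ext (endo_ext ?_ ?_)), ?_⟩
    · simp [f, g, mul_assoc]
    · simp [f, g, mul_assoc]
    · simp [f, g, mul_assoc]
    · simp [f, g, mul_assoc]
    · intro i
      fin_cases i
      · exact (endo_of_zero _ _ : f (FreeGroup.of 0) = _)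
      · exact (endo_of_one _ _ : f (FreeGroup.of 1) = _)
  · rintro ⟨p, hp⟩
    have h0 := (hp 0).1
    have h1 := (hp 1).1
    rw [← h0] at h1
    revert h1
    decide
  · intro p hp hc hinf
    obtain ⟨g, s, hg⟩ := hp.signedGenerated.exists_conj_mem_avoiding
    have h0 := count_eq_zero_of_conj_mem_avoiding hc.isCyclicallyReduced hg
    rw [List.count_eq_zero] at h0
    refine h0 (hinf.subset ?_)
    cases s <;> decide
end

section
/- In the free group F_r with r ≥ 3, for every integer k ≥ 1, the word x_1^k x_2^k ⋯ x_r^k is not primitivity-blocking; that is, there exists a cyclically reduced primitive element p of F_r whose reduced word contains the reduced word of x_1^k x_2^k ⋯ x_r^k as a contiguous subword (infix). -/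
/-- Multiplying the generator `i` on both sides by elements of the subgroup generated by the
other generators, and fixing those generators, extends to an automorphism. -/
theorem FreeGroup.exists_mulEquiv_of_mem_closure {α : Type*} (i : α) {u v : FreeGroup α}
    (hu : u ∈ Subgroup.closure (FreeGroup.of '' {i}ᶜ))
    (hv : v ∈ Subgroup.closure (FreeGroup.of '' {i}ᶜ)) :
    ∃ φ : FreeGroup α ≃* FreeGroup α, φ (FreeGroup.of i) = u * FreeGroup.of i * v ∧
      ∀ w ∈ Subgroup.closure (FreeGroup.of '' {i}ᶜ), φ w = w := by
  classical
  let f (s t : FreeGroup α) : FreeGroup α →* FreeGroup α :=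
    FreeGroup.lift fun j => if j = i then s * FreeGroup.of i * t else FreeGroup.of j
  have f_gen (s t) : f s t (FreeGroup.of i) = s * FreeGroup.of i * t := by simp [f]
  have f_fix (s t) : ∀ w ∈ Subgroup.closure (FreeGroup.of '' {i}ᶜ), f s t w = w := by
    intro w hw
    refine MonoidHom.eqOn_closure (f := f s t) (g := MonoidHom.id _) ?_ hw
    rintro _ ⟨j, hj, rfl⟩
    have hj' : j ≠ i := hj
    simp [f, hj']
  have f_comp {s t s' t'} (hs : s' ∈ Subgroup.closure (FreeGroup.of '' {i}ᶜ))
      (ht : t' ∈ Subgroup.closure (FreeGroup.of '' {i}ᶜ)) (h1 : s' * s = 1) (h2 : t * t' = 1) :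
      (f s t).comp (f s' t') = MonoidHom.id _ := by
    ext j
    by_cases hj : j = i
    · subst hj
      have : s' * (s * FreeGroup.of j * t) * t' = s' * s * FreeGroup.of j * (t * t') := by group
      simp [f_gen, f_fix s t _ hs, f_fix s t _ ht, this, h1, h2]
    · have hj' : FreeGroup.of j ∈ Subgroup.closure (FreeGroup.of '' {i}ᶜ) :=
        Subgroup.subset_closure ⟨j, hj, rfl⟩
      simp [f_fix _ _ _ hj']
  exact ⟨(f u v).toMulEquiv (f u⁻¹ v⁻¹)
    (f_comp hu hv (by simp) (by simp))
    (f_comp (inv_mem hu) (inv_mem hv) (by simp) (by simp)), f_gen u v, f_fix u v⟩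

/-- The word `x_{l_1}^k x_{l_2}^k ⋯` attached to a list of indices. -/
def powWord {α : Type*} (k : ℕ) (l : List α) : List (α × Bool) :=
  l.flatMap fun j => List.replicate k (j, true)

theorem mem_powWord {α : Type*} {k : ℕ} {l : List α} {a : α × Bool} (h : a ∈ powWord k l) :
    a.1 ∈ l ∧ a.2 = true := by
  simp only [powWord, List.mem_flatMap, List.mem_replicate] at h
  obtain ⟨j, hj, -, rfl⟩ := h
  exact ⟨hj, rfl⟩

theorem isReduced_powWord {α : Type*} (k : ℕ) (l : List α) :
    FreeGroup.IsReduced (powWord k l) := by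
  refine (List.pairwise_of_forall_mem_list fun a ha b hb _ => ?_).isChain
  rw [(mem_powWord ha).2, (mem_powWord hb).2]

theorem FreeGroup.mk_replicate {α : Type*} (n : ℕ) (a : α) (b : Bool) :
    FreeGroup.mk (List.replicate n (a, b)) = FreeGroup.mk [(a, b)] ^ n := by
  induction n with
  | zero => rfl
  | succ n ih => rw [pow_succ', ← ih, FreeGroup.mul_mk]; rfl

theorem mk_powWord {α : Type*} (k : ℕ) (l : List α) :
    FreeGroup.mk (powWord k l) = (l.map fun j => FreeGroup.of j ^ k).prod := by
  induction l with
  | nil => rfl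
  | cons a l ih =>
    rw [List.map_cons, List.prod_cons, ← ih, powWord, List.flatMap_cons, ← FreeGroup.mul_mk,
      FreeGroup.mk_replicate]
    rfl

theorem map_gen_range (r k : ℕ) :
    (List.range r).map (fun j => gen r j ^ k) =
      (List.finRange r).map fun j => FreeGroup.of j ^ k := by
  rw [← List.map_coe_finRange_eq_range, List.map_map]
  simp [gen, Function.comp_def]

/-- In `F_r` with `r ≥ 3`, for every `k ≥ 1` the word
`x_1^k x_2^k ⋯ x_r^k` is not primitivity-blocking: some cyclically reduced primitive
element contains its reduced word as an infix. -/
theorem not_pb_x1k_dots_xrk {r : ℕ} (hr : 3 ≤ r) (k : ℕ) (hk : 1 ≤ k) :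
    ∃ p : FG r, Primitive (by omega) p ∧ CyclicallyReduced p ∧
      (((List.range r).map (fun j => gen r j ^ k)).prod).toWord <:+: p.toWord := by
  obtain ⟨m, rfl⟩ : ∃ m, r = m + 3 := ⟨r - 3, by omega⟩
  obtain ⟨n, rfl⟩ : ∃ n, k = n + 1 := ⟨k - 1, by omega⟩
  rw [map_gen_range, ← mk_powWord, FreeGroup.toWord_mk, (isReduced_powWord _ _).reduce_eq]
  set t : List (Fin (m + 3)) := (List.finRange (m + 1)).map fun j => j.succ.succ with ht
  have hfin : List.finRange (m + 3) = 0 :: 1 :: t := by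
    simp [List.finRange_succ, ht, Function.comp_def]
  have htail : ∀ j ∈ t, j ≠ 0 ∧ j ≠ 1 := by
    intro j hj
    obtain ⟨i, -, rfl⟩ := List.mem_map.1 hj
    exact ⟨Fin.succ_ne_zero _, fun h => Fin.succ_ne_zero i (Fin.succ_injective _ h)⟩
  have hpos : powWord (n + 1) (List.finRange (m + 3)) =
      List.replicate (n + 1) (0, true) ++
        (List.replicate (n + 1) (1, true) ++ powWord (n + 1) t) := by
    rw [hfin]; rfl
  have hne : powWord (n + 1) t ≠ [] := by
    simp [powWord, ht, List.finRange_succ, List.replicate_succ]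
  set L := List.replicate n ((1 : Fin (m + 3)), false) ++
    powWord (n + 1) (List.finRange (m + 3)) with hL
  have hred : FreeGroup.IsReduced L := by
    refine List.isChain_append.2 ⟨?_, isReduced_powWord _ _, ?_⟩
    · exact List.isChain_replicate_of_rel _ fun _ => rfl
    · intro a ha b hb h
      have ha' := List.eq_of_mem_replicate (List.mem_of_mem_getLast? ha)
      rw [hpos] at hb
      simp [List.replicate_succ] at hb
      subst ha' hb
      simp at h
  have hword : (FreeGroup.mk L).toWord = L := by
    rw [FreeGroup.toWord_mk, hred.reduce_eq]
  refine ⟨FreeGroup.mk L, ?_, ?_, ?_⟩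
  · set v := FreeGroup.mk (powWord (n + 1) t) with hv
    have gen_mem {i j : Fin (m + 3)} (h : j ≠ i) :
        FreeGroup.of j ∈ Subgroup.closure (FreeGroup.of '' ({i}ᶜ : Set (Fin (m + 3)))) :=
      Subgroup.subset_closure ⟨j, h, rfl⟩
    have v_mem {i : Fin (m + 3)} (h : ∀ j ∈ t, j ≠ i) :
        v ∈ Subgroup.closure (FreeGroup.of '' ({i}ᶜ : Set (Fin (m + 3)))) := by
      rw [hv, mk_powWord]
      refine Subgroup.list_prod_mem _ fun x hx => ?_
      obtain ⟨j, hj, rfl⟩ := List.mem_map.1 hx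
      exact pow_mem (gen_mem (h j hj)) _
    have h01 : (0 : Fin (m + 3)) ≠ 1 := by simp
    obtain ⟨τ, hτ, -⟩ := FreeGroup.exists_mulEquiv_of_mem_closure 1
      (pow_mem (gen_mem h01) (n + 1)) (v_mem fun j hj => (htail j hj).2)
    obtain ⟨χ, hχ, χ_fix⟩ := FreeGroup.exists_mulEquiv_of_mem_closure 0
      (inv_mem (pow_mem (gen_mem h01.symm) n)) (pow_mem (gen_mem h01.symm) n)
    refine ⟨((FreeGroup.freeGroupCongr (Equiv.swap 0 1)).trans τ).trans χ, ?_⟩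
    have hswap : FreeGroup.freeGroupCongr (Equiv.swap (0 : Fin (m + 3)) 1)
        (FreeGroup.of ⟨0, by omega⟩) = FreeGroup.of 1 := by
      simp
    have hinv : FreeGroup.mk [((1 : Fin (m + 3)), false)] = (FreeGroup.of 1)⁻¹ := rfl
    have hof (j : Fin (m + 3)) : FreeGroup.mk [(j, true)] = FreeGroup.of j := rfl
    have hconj : ((FreeGroup.of (1 : Fin (m + 3)) ^ n)⁻¹ * FreeGroup.of 0 *
        FreeGroup.of 1 ^ n) ^ (n + 1) =
        (FreeGroup.of 1 ^ n)⁻¹ * FreeGroup.of 0 ^ (n + 1) * FreeGroup.of 1 ^ n := by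
      simpa using conj_pow (i := n + 1) (a := (FreeGroup.of (1 : Fin (m + 3)) ^ n)⁻¹)
        (b := FreeGroup.of 0)
    rw [MulEquiv.trans_apply, MulEquiv.trans_apply, hswap, hτ, map_mul, map_mul, map_pow, hχ,
      χ_fix _ (gen_mem h01.symm), χ_fix _ (v_mem fun j hj => (htail j hj).1), hL, hpos]
    simp only [← FreeGroup.mul_mk, FreeGroup.mk_replicate, hinv, hof, ← hv, hconj]
    simp only [inv_pow, pow_succ, mul_assoc]
  · intro a ha b hb h
    rw [hword] at ha hb
    have hb' : b ∈ powWord (n + 1) t := by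
      rw [hL, hpos, List.getLast?_append_of_ne_nil _ (by simp),
        List.getLast?_append_of_ne_nil _ (by simp), List.getLast?_append_of_ne_nil _ hne] at hb
      exact List.mem_of_mem_getLast? hb
    obtain ⟨hbt, hb2⟩ := mem_powWord hb'
    rcases List.mem_append.1 (List.mem_of_mem_head? ha) with ha | ha
    · rw [List.eq_of_mem_replicate ha] at h
      exact (htail _ hbt).2 (congrArg Prod.fst h).symm
    · have := (mem_powWord ha).2
      rw [h, hb2] at this
      simp at this
  · rw [hword]
    exact (List.suffix_append _ _).isInfix
end
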